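/- Let ψ : Z → Γ be a surjective simplicial map (with respect to some triangulations) with connected fibers between topological spaces Z and Γ. If Z is simply connected (π_1(Z) = 0), then Γ is simply connected (π_1(Γ) = 0). -/

import Mathlib

open TopologicalSpace Set

/-! ### Finite simplicial complexes, triangulations, and simplicial maps -/

/-- An abstract finite simplicial complex with vertex set `Fin N`. -/
structure FinSimplicialComplex (N : ℕ) where
  /-- the faces (simplices) of the complex -/
  faces : Set (Finset (Fin N))
  nonempty_of_mem : ∀ s ∈ faces, s.Nonempty
  down_closed : ∀ s ∈ faces, ∀ t, t ⊆ s → t.Nonempty → t ∈ faces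

/-- The geometric realization of a finite simplicial complex, inside `Fin N → ℝ`:
the union of the geometric simplices spanned by the basis vectors indexed by the
faces. -/
def FinSimplicialComplex.space {N : ℕ} (C : FinSimplicialComplex N) :
    Set (Fin N → ℝ) :=
  {x | (∀ i, 0 ≤ x i) ∧ ∑ i, x i = 1 ∧ ∃ s ∈ C.faces, ∀ i, x i ≠ 0 → i ∈ s}

/-- The part of the realization of `C` lying on a given collection `S` of faces (the
realization of the subcomplex generated by `S`). -/
def FinSimplicialComplex.subspace {N : ℕ} (C : FinSimplicialComplex N)
    (S : Set (Finset (Fin N))) : Set ↥C.space :=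
  {x | ∃ s ∈ S, ∀ i, (x : Fin N → ℝ) i ≠ 0 → i ∈ s}

/-- A triangulation of a topological space `T`: a finite simplicial complex together
with a homeomorphism of `T` with its geometric realization. -/
structure Triangulation (T : Type*) [TopologicalSpace T] where
  /-- the number of vertices -/
  N : ℕ
  /-- the simplicial complex -/
  complex : FinSimplicialComplex N
  /-- the homeomorphism with the geometric realization -/
  homeo : T ≃ₜ ↥complex.space

/-- The affine map of geometric realizations induced by a vertex map `v`. -/
def simplicialPush {N N' : ℕ} (v : Fin N → Fin N') (x : Fin N → ℝ) : Fin N' → ℝ :=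
  fun j => ∑ i ∈ Finset.univ.filter (fun i => v i = j), x i

/-- `ψ : T → T'` is a simplicial map with respect to the triangulations `Θ` of `T` and
`Θ'` of `T'`: it is induced by a map on vertices sending faces to faces and affine on
every simplex. -/
def IsSimplicialMap {T T' : Type*} [TopologicalSpace T] [TopologicalSpace T']
    (Θ : Triangulation T) (Θ' : Triangulation T') (ψ : T → T') : Prop :=
  ∃ v : Fin Θ.N → Fin Θ'.N,
    (∀ s ∈ Θ.complex.faces, s.image v ∈ Θ'.complex.faces) ∧
    ∀ t : T, (Θ'.homeo (ψ t) : Fin Θ'.N → ℝ) = simplicialPush v (Θ.homeo t)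

section LiftedPaths

open Path
open scoped Topology unitInterval

variable {Z Y : Type*} [TopologicalSpace Z] [TopologicalSpace Y]

/-- Two paths with values in a simply connected subset are homotopic in the ambient space. -/
theorem IsSimplyConnected.homotopic_of_forall_mem {U : Set Y} (hU : IsSimplyConnected U)
    {y y' : Y} (p q : Path y y') (hp : ∀ t, p t ∈ U) (hq : ∀ t, q t ∈ U) : p.Homotopic q := by
  have := hU.simplyConnectedSpace
  have hy : y ∈ U := by simpa using hp 0
  have hy' : y' ∈ U := by simpa using hp 1
  let p' : Path (⟨y, hy⟩ : U) ⟨y', hy'⟩ :=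
    { toFun := fun t ↦ ⟨p t, hp t⟩, source' := by simp, target' := by simp }
  let q' : Path (⟨y, hy⟩ : U) ⟨y', hy'⟩ :=
    { toFun := fun t ↦ ⟨q t, hq t⟩, source' := by simp, target' := by simp }
  exact (SimplyConnectedSpace.paths_homotopic p' q').map ⟨Subtype.val, continuous_subtype_val⟩

/-- `c` is the homotopy class of the image under `f` of a path starting at `z₀`. -/
def IsLiftableClass (f : C(Z, Y)) (z₀ : Z) {y : Y} (c : Homotopic.Quotient (f z₀) y) : Prop :=
  ∃ (z : Z) (p : Path z₀ z) (h : f z = y),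
    c = (Homotopic.Quotient.mk (p.map f.continuous)).cast rfl h.symm

theorem IsLiftableClass.refl (f : C(Z, Y)) (z₀ : Z) :
    IsLiftableClass f z₀ (Homotopic.Quotient.refl (f z₀)) :=
  ⟨z₀, Path.refl z₀, rfl, rfl⟩

theorem IsLiftableClass.cast {f : C(Z, Y)} {z₀ : Z} {y y' : Y}
    {c : Homotopic.Quotient (f z₀) y} (hc : IsLiftableClass f z₀ c) (h : y' = y) :
    IsLiftableClass f z₀ (c.cast rfl h) := by
  subst h
  simpa using hc

/-- If `Z` is simply connected and `f ⁻¹' U` is path connected, then any path inside `U` carries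
a liftable class at its source to the liftable class at its target. -/
theorem IsLiftableClass.trans_eq [SimplyConnectedSpace Z] {f : C(Z, Y)} {z₀ : Z} {U : Set Y}
    (hU : IsSimplyConnected U) (hfU : IsPathConnected (f ⁻¹' U)) {y y' : Y}
    {c : Homotopic.Quotient (f z₀) y} {c' : Homotopic.Quotient (f z₀) y'}
    (hc : IsLiftableClass f z₀ c) (hc' : IsLiftableClass f z₀ c') (q : Path y y')
    (hq : ∀ t, q t ∈ U) : c.trans (Homotopic.Quotient.mk q) = c' := by
  obtain ⟨z, p, rfl, rfl⟩ := hc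
  obtain ⟨z', p', rfl, rfl⟩ := hc'
  obtain ⟨r, hr⟩ := hfU.joinedIn z (by simpa using hq 0) z' (by simpa using hq 1)
  have hrq : (r.map f.continuous).Homotopic q := hU.homotopic_of_forall_mem _ _ hr hq
  have hp' : ((p.trans r).map f.continuous).Homotopic (p'.map f.continuous) :=
    (SimplyConnectedSpace.paths_homotopic _ _).map f
  rw [Path.map_trans] at hp'
  simpa [← Homotopic.Quotient.eq.mpr hrq] using Homotopic.Quotient.eq.mpr hp'

theorem Path.Homotopic.Quotient.trans_mk_cast {x₀ x y x' y' : Y}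
    (c : Homotopic.Quotient x₀ x') (p : Path x y) (hx : x' = x) (hy : y' = y) :
    c.trans (mk (p.cast hx hy)) = ((c.cast rfl hx.symm).trans (mk p)).cast rfl hy := by
  subst hx hy
  simp

/-- If `Z` is simply connected and `f : Z → Y` is a surjection such that `Y` is covered by the
interiors of simply connected sets with path connected preimage, then `Y` is simply connected. -/
theorem SimplyConnectedSpace.of_surjective_of_exists_mem_nhds [SimplyConnectedSpace Z]
    {f : Z → Y} (hf : Continuous f) (hsurj : Function.Surjective f)
    (h : ∀ y, ∃ U ∈ 𝓝 y, IsSimplyConnected U ∧ IsPathConnected (f ⁻¹' U)) :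
    SimplyConnectedSpace Y := by
  rw [simply_connected_iff_paths_homotopic']
  refine ⟨hsurj.pathConnectedSpace hf, fun {x y} ↦ ?_⟩
  obtain ⟨z₀, rfl⟩ := hsurj x
  obtain ⟨f, rfl⟩ : ∃ g : C(Z, Y), f = g := ⟨⟨f, hf⟩, rfl⟩
  have hex (y : Y) : ∃ c : Homotopic.Quotient (f z₀) y, IsLiftableClass f z₀ c := by
    obtain ⟨z, rfl⟩ := hsurj y
    exact ⟨_, z, PathConnectedSpace.somePath z₀ z, rfl, rfl⟩
  choose κ hκ using hex
  suffices H : ∀ q : Path (f z₀) y, Homotopic.Quotient.mk q = κ y from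
    fun p q ↦ Homotopic.Quotient.eq.mp ((H p).trans (H q).symm)
  intro q
  have hloc : IsLocallyConstant
      fun t : I ↦ (κ (q t)).trans (Homotopic.Quotient.mk (q.subpath t 1)) := by
    refine (IsLocallyConstant.iff_eventually_eq _).2 fun t₀ ↦ ?_
    obtain ⟨U, hUn, hU, hfU⟩ := h (q t₀)
    have hmem : ∀ᶠ t in 𝓝 t₀, uIcc t t₀ ⊆ q ⁻¹' U := by
      have := Filter.Tendsto.uIcc (Filter.tendsto_id (x := 𝓝 t₀))
        (tendsto_const_nhds (x := t₀) (f := 𝓝 t₀))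
      exact (this.eventually (Filter.eventually_smallSets_subset.2
        (q.continuous.continuousAt hUn)))
    filter_upwards [hmem] with t ht
    have hrange (s : I) : q.subpath t t₀ s ∈ U := by
      have : q.subpath t t₀ s ∈ Set.range (q.subpath t t₀) := ⟨s, rfl⟩
      rw [Path.range_subpath] at this
      obtain ⟨r, hr, hrs⟩ := this
      exact hrs ▸ ht hr
    rw [← (hκ (q t)).trans_eq hU hfU (hκ (q t₀)) (q.subpath t t₀) hrange,
      Homotopic.Quotient.trans_assoc, ← Homotopic.Quotient.mk_trans]
    congr 1
    exact Homotopic.Quotient.eq.mpr ⟨(Path.Homotopy.subpathTransSubpath q t t₀ 1).symm⟩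
  have hrefl {c : Homotopic.Quotient (f z₀) (f z₀)} (hc : IsLiftableClass f z₀ c) :
      c = Homotopic.Quotient.refl _ := by
    obtain ⟨U, hUn, hU, hfU⟩ := h (f z₀)
    simpa using hc.trans_eq hU hfU (.refl f z₀) (Path.refl _) fun _ ↦ mem_of_mem_nhds hUn
  have hend := hloc.apply_eq_of_preconnectedSpace 0 1
  have hcast {y' : Y} (h : y' = y) : (κ y').cast rfl h.symm = κ y := by subst h; simp
  rw [Path.subpath_zero_one, Path.subpath_self, Homotopic.Quotient.trans_mk_cast,
    hrefl ((hκ (q 0)).cast _)] at hend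
  have := congrArg (fun c ↦ c.cast rfl q.target.symm) hend
  simpa [hcast q.target] using this

end LiftedPaths

section Realization

open scoped Topology

variable {N N' : ℕ}

theorem simplicialPush_add (v : Fin N → Fin N') (x y : Fin N → ℝ) :
    simplicialPush v (x + y) = simplicialPush v x + simplicialPush v y := by
  ext j
  simp [simplicialPush, Finset.sum_add_distrib]

theorem simplicialPush_smul (v : Fin N → Fin N') (a : ℝ) (x : Fin N → ℝ) :
    simplicialPush v (a • x) = a • simplicialPush v x := by
  ext j
  simp [simplicialPush, Finset.mul_sum]

theorem continuous_simplicialPush (v : Fin N → Fin N') : Continuous (simplicialPush v) := by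
  unfold simplicialPush
  fun_prop

namespace FinSimplicialComplex

variable (C : FinSimplicialComplex N)

/-- The realization contains the segment between two points lying on a common face. -/
theorem segment_subset_space {x y : Fin N → ℝ} {s : Finset (Fin N)} (hs : s ∈ C.faces)
    (hx : x ∈ C.space) (hy : y ∈ C.space) (hxs : ∀ i, x i ≠ 0 → i ∈ s)
    (hys : ∀ i, y i ≠ 0 → i ∈ s) : segment ℝ x y ⊆ C.space := by
  rintro _ ⟨a, b, ha, hb, hab, rfl⟩
  refine ⟨fun i ↦ ?_, ?_, s, hs, fun i hi ↦ ?_⟩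
  · have := hx.1 i
    have := hy.1 i
    simp only [Pi.add_apply, Pi.smul_apply, smul_eq_mul]
    positivity
  · simp [Finset.sum_add_distrib, ← Finset.mul_sum, hx.2.1, hy.2.1, hab]
  · by_contra his
    have hxi : x i = 0 := by_contra fun h ↦ his (hxs i h)
    have hyi : y i = 0 := by_contra fun h ↦ his (hys i h)
    simp [hxi, hyi] at hi

theorem single_mem_space {x : Fin N → ℝ} (hx : x ∈ C.space) {j : Fin N} (hj : 0 < x j) :
    Pi.single j 1 ∈ C.space := by
  obtain ⟨s, hs, hxs⟩ := hx.2.2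
  refine ⟨fun i ↦ ?_, by simp, {j}, C.down_closed s hs _ ?_ (by simp), fun i hi ↦ ?_⟩
  · by_cases h : i = j
    · subst h; simp
    · simp [h]
  · simpa using hxs j hj.ne'
  · by_contra h
    simp at h
    simp [h] at hi

theorem exists_pos_of_mem_space {x : Fin N → ℝ} (hx : x ∈ C.space) : ∃ j, 0 < x j := by
  by_contra! h
  have : ∑ i, x i ≤ 0 := Finset.sum_nonpos fun i _ ↦ h i
  linarith [hx.2.1]

/-- The open star of a vertex is star-shaped about that vertex. -/
theorem starConvex_openStar (j : Fin N) :
    StarConvex ℝ (Pi.single j 1) {x ∈ C.space | 0 < x j} := by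
  rw [starConvex_iff_segment_subset]
  rintro x ⟨hx, hxj⟩ y hy
  obtain ⟨s, hs, hxs⟩ := hx.2.2
  have hsupp (i : Fin N) (hi : (Pi.single j 1 : Fin N → ℝ) i ≠ 0) : i ∈ s := by
    obtain rfl : i = j := by
      by_contra h
      simp [h] at hi
    exact hxs i hxj.ne'
  refine ⟨C.segment_subset_space hs (C.single_mem_space hx hxj) hx hsupp hxs hy, ?_⟩
  have hconv : Convex ℝ {y : Fin N → ℝ | 0 < y j} :=
    convex_halfSpace_gt (IsLinearMap.mk (fun _ _ ↦ rfl) fun _ _ ↦ rfl) 0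
  exact hconv.segment_subset (by simp) hxj hy

theorem isSimplyConnected_openStar {j : Fin N} (h : {x ∈ C.space | 0 < x j}.Nonempty) :
    IsSimplyConnected {x ∈ C.space | 0 < x j} := by
  have := (C.starConvex_openStar j).contractibleSpace h
  exact SimplyConnectedSpace.ofContractible _

/-- Preconnected fibers of a simplicial map are path connected. -/
theorem joinedIn_fiber (v : Fin N → Fin N') (y : Fin N' → ℝ)
    (hF : IsPreconnected {x ∈ C.space | simplicialPush v x = y}) {x x' : Fin N → ℝ}
    (hx : x ∈ {x ∈ C.space | simplicialPush v x = y})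
    (hx' : x' ∈ {x ∈ C.space | simplicialPush v x = y}) :
    JoinedIn {x ∈ C.space | simplicialPush v x = y} x x' := by
  refine hF.induction₂ (JoinedIn {x ∈ C.space | simplicialPush v x = y})
    (fun p hp ↦ ?_) (fun _ _ _ _ _ _ ↦ JoinedIn.trans) (fun _ _ _ _ ↦ JoinedIn.symm) hx hx'
  have hev : ∀ᶠ q in 𝓝 p, ∀ i, p i ≠ 0 → q i ≠ 0 := by
    refine Filter.eventually_all.2 fun i ↦ Filter.eventually_imp_distrib_left.2 fun hi ↦ ?_
    exact (continuous_apply i).continuousAt.eventually_ne hi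
  filter_upwards [nhdsWithin_le_nhds hev, self_mem_nhdsWithin] with q hpq hq
  obtain ⟨s, hs, hqs⟩ := hq.1.2.2
  refine JoinedIn.of_segment_subset fun z hz ↦
    ⟨C.segment_subset_space hs hp.1 hq.1 (fun i hi ↦ hqs i (hpq i hi)) hqs hz, ?_⟩
  obtain ⟨a, b, ha, hb, hab, rfl⟩ := hz
  rw [simplicialPush_add, simplicialPush_smul, simplicialPush_smul, hp.2, hq.2, ← add_smul, hab,
    one_smul]

/-- A point of the preimage of the open star of `j` can be pushed, within that preimage,
into the fiber over the vertex `j`. -/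
theorem exists_joinedIn_fiber_single (v : Fin N → Fin N') {j : Fin N'} {x : Fin N → ℝ}
    (hx : x ∈ C.space) (hj : 0 < simplicialPush v x j) :
    ∃ w ∈ {w ∈ C.space | simplicialPush v w = Pi.single j 1},
      JoinedIn {x ∈ C.space | 0 < simplicialPush v x j} x w := by
  obtain ⟨m, hm⟩ : ∃ m, m = simplicialPush v x j := ⟨_, rfl⟩
  rw [← hm] at hj
  let w : Fin N → ℝ := fun i ↦ if v i = j then m⁻¹ * x i else 0
  obtain ⟨s, hs, hxs⟩ := hx.2.2
  have hws (i : Fin N) (hi : w i ≠ 0) : i ∈ s := hxs i fun h ↦ hi (by simp [w, h])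
  have hw : simplicialPush v w = Pi.single j 1 := by
    ext k
    by_cases hk : k = j
    · subst hk
      have : simplicialPush v w k = m⁻¹ * simplicialPush v x k := by
        rw [simplicialPush, simplicialPush, Finset.mul_sum]
        exact Finset.sum_congr rfl fun i hi ↦ by simp [w, (Finset.mem_filter.1 hi).2]
      simp [this, ← hm, hj.ne']
    · rw [Pi.single_eq_of_ne hk]
      exact Finset.sum_eq_zero fun i hi ↦ by simp [w, (Finset.mem_filter.1 hi).2, hk]
  have hwC : w ∈ C.space := by
    refine ⟨fun i ↦ ?_, ?_, s, hs, hws⟩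
    · have := hx.1 i
      dsimp only [w]
      split_ifs <;> positivity
    · have := congrFun hw j
      rw [Pi.single_eq_same, simplicialPush, Finset.sum_filter] at this
      rw [← this]
      exact Finset.sum_congr rfl fun i _ ↦ by simp +contextual [w]
  refine ⟨w, ⟨hwC, hw⟩, JoinedIn.of_segment_subset fun z hz ↦
    ⟨C.segment_subset_space hs hx hwC hxs hws hz, ?_⟩⟩
  have hconv : Convex ℝ {z : Fin N → ℝ | 0 < simplicialPush v z j} :=
    convex_halfSpace_gt (IsLinearMap.mk (fun x y ↦ congrFun (simplicialPush_add v x y) j)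
      fun a x ↦ congrFun (simplicialPush_smul v a x) j) 0
  exact hconv.segment_subset (by simpa [← hm] using hj) (by simp [hw]) hz

theorem isPathConnected_preimage_openStar (v : Fin N → Fin N') (j : Fin N')
    (hF : IsConnected {x ∈ C.space | simplicialPush v x = Pi.single j 1}) :
    IsPathConnected {x ∈ C.space | 0 < simplicialPush v x j} := by
  obtain ⟨x₀, hx₀⟩ := hF.nonempty
  have hsub : {x ∈ C.space | simplicialPush v x = Pi.single j 1} ⊆
      {x ∈ C.space | 0 < simplicialPush v x j} := fun x hx ↦ ⟨hx.1, by simp [hx.2]⟩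
  refine ⟨x₀, hsub hx₀, fun {x} hx ↦ ?_⟩
  obtain ⟨w, hw, hxw⟩ := C.exists_joinedIn_fiber_single v hx.1 hx.2
  exact ((C.joinedIn_fiber v _ hF.isPreconnected hx₀ hw).mono hsub).trans hxw.symm

end FinSimplicialComplex

namespace Triangulation

variable {T : Type*} [TopologicalSpace T] (Θ : Triangulation T)

theorem isEmbedding_coe_homeo : Topology.IsEmbedding fun t ↦ (Θ.homeo t : Fin Θ.N → ℝ) :=
  Topology.IsEmbedding.subtypeVal.comp Θ.homeo.isEmbedding

theorem image_coe_homeo_preimage (P : (Fin Θ.N → ℝ) → Prop) :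
    (fun t ↦ (Θ.homeo t : Fin Θ.N → ℝ)) '' {t | P (Θ.homeo t)} = {x ∈ Θ.complex.space | P x} := by
  ext x
  constructor
  · rintro ⟨t, ht, rfl⟩
    exact ⟨(Θ.homeo t).2, ht⟩
  · rintro ⟨hx, hP⟩
    exact ⟨Θ.homeo.symm ⟨x, hx⟩, by simpa using hP, by simp⟩

end Triangulation

end Realization

/-- **Lemma (reduction step).** Let `ψ : Z → Γ` be a surjective simplicial map (with
respect to some triangulations) with connected fibers between topological spaces.
If `Z` is simply connected then so is `Γ`. -/
theorem simply_connected_of_simplicial_surjection_connected_fibers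
    (Z Γ : Type) [TopologicalSpace Z] [TopologicalSpace Γ]
    (Θ : Triangulation Z) (Θ' : Triangulation Γ) (ψ : Z → Γ)
    (hsimp : IsSimplicialMap Θ Θ' ψ)
    (hsurj : Function.Surjective ψ)
    (hfib : ∀ γ : Γ, IsConnected (ψ ⁻¹' {γ}))
    (hZ : SimplyConnectedSpace Z) :
    SimplyConnectedSpace Γ := by
  obtain ⟨v, -, hv⟩ := hsimp
  have hψ : Continuous ψ := by
    rw [Θ'.isEmbedding_coe_homeo.continuous_iff]
    exact ((continuous_simplicialPush v).comp Θ.isEmbedding_coe_homeo.continuous).congr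
      fun t ↦ (hv t).symm
  refine SimplyConnectedSpace.of_surjective_of_exists_mem_nhds hψ hsurj fun y ↦ ?_
  obtain ⟨j, hj⟩ := Θ'.complex.exists_pos_of_mem_space (Θ'.homeo y).2
  refine ⟨{y | 0 < (Θ'.homeo y : Fin Θ'.N → ℝ) j}, ?_, ?_, ?_⟩
  · exact (isOpen_lt continuous_const
      ((continuous_apply j).comp Θ'.isEmbedding_coe_homeo.continuous)).mem_nhds hj
  · rw [← Θ'.isEmbedding_coe_homeo.isSimplyConnected_image,
      Θ'.image_coe_homeo_preimage fun x ↦ 0 < x j]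
    exact Θ'.complex.isSimplyConnected_openStar ⟨_, (Θ'.homeo y).2, hj⟩
  · have hvertex := Θ'.complex.single_mem_space (Θ'.homeo y).2 hj
    have hpre : ψ ⁻¹' {y | 0 < (Θ'.homeo y : Fin Θ'.N → ℝ) j} =
        {t | 0 < simplicialPush v (Θ.homeo t) j} := by
      ext t
      simp [hv]
    have hfiber : ψ ⁻¹' {Θ'.homeo.symm ⟨_, hvertex⟩} =
        {t | simplicialPush v (Θ.homeo t) = Pi.single j 1} := by
      ext t
      simp [← hv, Subtype.ext_iff, ← Θ'.homeo.apply_eq_iff_eq]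
    rw [hpre, Θ.isEmbedding_coe_homeo.isInducing.isPathConnected_iff,
      Θ.image_coe_homeo_preimage fun x ↦ 0 < simplicialPush v x j]
    refine Θ.complex.isPathConnected_preimage_openStar v j ?_
    rw [← Θ.image_coe_homeo_preimage fun x ↦ simplicialPush v x = Pi.single j 1, ← hfiber]
    exact (hfib _).image _ Θ.isEmbedding_coe_homeo.continuous.continuousOn
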